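/- Assume g is increasing and that κ(y) is finite for every y ∈ ℝ. Then for every x ∈ ℝ, G(x) = E[∫_0^∞ (sup_{0≤s≤t} κ(x + X_s)) r e^{−rt} dt]. Analogously, if instead g is decreasing and μ(y) := ∫_0^∞ E[g(y + X̄_t)] e^{−rt} dt is finite for every y, then G(x) = E[∫_0^∞ (sup_{0≤s≤t} μ(x + X_s)) r e^{−rt} dt]. -/

import Mathlib

open MeasureTheory Set Filter
open scoped ENNReal NNReal

noncomputable section

/-- The running supremum `X̄_t = sup_{0 ≤ s ≤ t} X_s` of a process. -/
def runSup {Ω : Type*} (X : ℝ → Ω → ℝ) (t : ℝ) (ω : Ω) : ℝ :=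
  sSup ((fun s => X s ω) '' Set.Icc 0 t)

/-- The running infimum `X̲_t = inf_{0 ≤ s ≤ t} X_s` of a process. -/
def runInf {Ω : Type*} (X : ℝ → Ω → ℝ) (t : ℝ) (ω : Ω) : ℝ :=
  sInf ((fun s => X s ω) '' Set.Icc 0 t)

/-- `G(x) = E[∫_0^∞ g(x + X_t) e^{-rt} dt]`. -/
def Gfun {Ω : Type*} [MeasurableSpace Ω] (P : Measure Ω) (X : ℝ → Ω → ℝ)
    (g : ℝ → ℝ) (r x : ℝ) : ℝ :=
  ∫ ω, (∫ t in Set.Ici (0:ℝ), g (x + X t ω) * Real.exp (-r * t)) ∂P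

/-- The Gittins index `κ(y) = ∫_0^∞ E[g(y + X̲_t)] e^{-rt} dt`. -/
def gittinsInf {Ω : Type*} [MeasurableSpace Ω] (P : Measure Ω) (X : ℝ → Ω → ℝ)
    (g : ℝ → ℝ) (r y : ℝ) : ℝ :=
  ∫ t in Set.Ici (0:ℝ), (∫ ω, g (y + runInf X t ω) ∂P) * Real.exp (-r * t)

/-- The dual index `μ(y) = ∫_0^∞ E[g(y + X̄_t)] e^{-rt} dt`. -/
def gittinsSup {Ω : Type*} [MeasurableSpace Ω] (P : Measure Ω) (X : ℝ → Ω → ℝ)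
    (g : ℝ → ℝ) (r y : ℝ) : ℝ :=
  ∫ t in Set.Ici (0:ℝ), (∫ ω, g (y + runSup X t ω) ∂P) * Real.exp (-r * t)

section RandomWalk

open ProbabilityTheory

/-- Partial sums of a real sequence, i.e. the walk with the given steps. -/
def partialSum (v : ℕ → ℝ) (n : ℕ) : ℝ := ∑ i ∈ Finset.range n, v i

/-- Running maximum of the walk with the given steps. -/
def walkMax (v : ℕ → ℝ) (n : ℕ) : ℝ :=
  (Finset.range (n + 1)).sup' Finset.nonempty_range_add_one (partialSum v)

open Classical in
/-- `F` of the walk at time `k`, on the event that a strict record is set at time `k`. -/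
def recordTerm (F : ℝ → ℂ) (k : ℕ) (v : ℕ → ℝ) : ℂ :=
  if ∀ j < k, partialSum v j < partialSum v k then F (partialSum v k) else 0

open Classical in
/-- `H` of the walk at time `m`, on the event that it has stayed nonpositive. -/
def nonposTerm (H : ℝ → ℂ) (m : ℕ) (v : ℕ → ℝ) : ℂ :=
  if ∀ j ≤ m, partialSum v j ≤ 0 then H (partialSum v m) else 0

lemma partialSum_congr {v w : ℕ → ℝ} {n : ℕ} (h : ∀ i < n, v i = w i) :
    partialSum v n = partialSum w n :=
  Finset.sum_congr rfl fun i hi => h i (Finset.mem_range.1 hi)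

lemma partialSum_shift (v : ℕ → ℝ) (k j : ℕ) :
    partialSum (fun i => v (k + i)) j = partialSum v (k + j) - partialSum v k := by
  simp [partialSum, Finset.sum_range_add]

lemma partialSum_neg (v : ℕ → ℝ) (n : ℕ) :
    partialSum (fun i => -v i) n = -partialSum v n := by
  simp [partialSum]

lemma recordTerm_congr (F : ℝ → ℂ) {k : ℕ} {v w : ℕ → ℝ} (h : ∀ i < k, v i = w i) :
    recordTerm F k v = recordTerm F k w := by
  have hk := partialSum_congr h
  have : ∀ j < k, partialSum v j = partialSum w j := fun j hj =>
    partialSum_congr fun i hi => h i (hi.trans hj)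
  simp +contextual only [recordTerm, hk, this]

lemma nonposTerm_congr (H : ℝ → ℂ) {m : ℕ} {v w : ℕ → ℝ} (h : ∀ i < m, v i = w i) :
    nonposTerm H m v = nonposTerm H m w := by
  have hk := partialSum_congr h
  have : ∀ j ≤ m, partialSum v j = partialSum w j := fun j hj =>
    partialSum_congr fun i hi => h i (hi.trans_le hj)
  simp +contextual only [nonposTerm, hk, this]

lemma partialSum_le_walkMax (v : ℕ → ℝ) {j n : ℕ} (h : j ≤ n) :
    partialSum v j ≤ walkMax v n :=
  Finset.le_sup' _ (Finset.mem_range.2 (by omega))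

lemma exists_partialSum_eq_walkMax (v : ℕ → ℝ) (n : ℕ) :
    ∃ k, k ≤ n ∧ walkMax v n = partialSum v k := by
  obtain ⟨k, hk, h⟩ := Finset.exists_mem_eq_sup' (s := Finset.range (n + 1))
    Finset.nonempty_range_add_one (partialSum v)
  exact ⟨k, by simpa [Nat.lt_succ_iff] using hk, h⟩

/-- Decomposition of a path at the first time at which its maximum is attained. -/
lemma walkMax_decomposition (F H : ℝ → ℂ) (v : ℕ → ℝ) (n : ℕ) :
    F (walkMax v n) * H (partialSum v n - walkMax v n) =
      ∑ k ∈ Finset.range (n + 1),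
        recordTerm F k v * nonposTerm H (n - k) (fun i => v (k + i)) := by
  classical
  have hex := exists_partialSum_eq_walkMax v n
  obtain ⟨hkn, hk⟩ := Nat.find_spec hex
  set k := Nat.find hex with hkdef
  have hfirst : ∀ j < k, partialSum v j < partialSum v k := fun j hj => by
    have h1 := Nat.find_min hex hj
    have h2 := partialSum_le_walkMax v (hj.le.trans hkn)
    rw [← hk]
    exact lt_of_le_of_ne h2 fun h => h1 ⟨hj.le.trans hkn, h.symm⟩
  rw [Finset.sum_eq_single k]
  · rw [recordTerm, if_pos hfirst, nonposTerm, if_pos, partialSum_shift, hk,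
      Nat.add_sub_cancel' hkn]
    intro j hj
    rw [partialSum_shift, ← hk, sub_nonpos]
    exact partialSum_le_walkMax v (by omega)
  · intro l hl hlk
    have hln : l ≤ n := by simpa [Nat.lt_succ_iff] using hl
    rcases lt_or_gt_of_ne hlk with h | h
    · rw [nonposTerm, if_neg, mul_zero]
      intro hall
      have h3 := hall (k - l) (by omega)
      rw [partialSum_shift, Nat.add_sub_cancel' h.le] at h3
      linarith [hfirst l h]
    · rw [recordTerm, if_neg, zero_mul]
      intro hall
      have h3 := hall k h
      rw [← hk] at h3
      linarith [partialSum_le_walkMax v hln]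
  · intro h
    exact absurd (Finset.mem_range.2 (by omega)) h

/-- Reversal of the first `n` indices. -/
def reverseIndex (n i : ℕ) : ℕ := if i < n then n - 1 - i else i

lemma reverseIndex_injective (n : ℕ) : Function.Injective (reverseIndex n) := by
  intro a b h
  simp only [reverseIndex] at h
  split_ifs at h <;> omega

lemma partialSum_reverse (v : ℕ → ℝ) {n j : ℕ} (hj : j ≤ n) :
    partialSum (fun i => v (reverseIndex n i)) j = partialSum v n - partialSum v (n - j) := by
  induction j with
  | zero => simp [partialSum]
  | succ j ih =>
    rw [partialSum, Finset.sum_range_succ, ← partialSum, ih (by omega)]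
    have h1 : n - j = (n - (j + 1)) + 1 := by omega
    have h2 : reverseIndex n j = n - (j + 1) := by
      simp only [reverseIndex]; split_ifs <;> omega
    rw [h2, h1, partialSum, partialSum, partialSum, Finset.sum_range_succ]
    ring

lemma neg_walkMax_neg_reverse (v : ℕ → ℝ) (n : ℕ) :
    -walkMax (fun i => -v (reverseIndex n i)) n = partialSum v n - walkMax v n := by
  have key : ∀ j ≤ n, partialSum (fun i => -v (reverseIndex n i)) j =
      partialSum v (n - j) - partialSum v n := fun j hj => by
    rw [partialSum_neg (fun i => v (reverseIndex n i)), partialSum_reverse v hj]; ring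
  obtain ⟨k, hk, h⟩ := exists_partialSum_eq_walkMax v n
  obtain ⟨l, hl, h'⟩ := exists_partialSum_eq_walkMax (fun i => -v (reverseIndex n i)) n
  have h1 := partialSum_le_walkMax (fun i => -v (reverseIndex n i)) (j := n - k) (n := n)
    (by omega)
  rw [key _ (by omega), Nat.sub_sub_self hk] at h1
  rw [key l hl] at h'
  have h2 := partialSum_le_walkMax v (j := n - l) (n := n) (by omega)
  linarith

lemma measurable_partialSum (n : ℕ) : Measurable fun v : ℕ → ℝ => partialSum v n := by
  unfold partialSum; fun_prop

lemma measurable_walkMax (n : ℕ) : Measurable fun v : ℕ → ℝ => walkMax v n :=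
  Finset.measurable_range_sup'' fun k _ => measurable_partialSum k

lemma measurable_recordTerm {F : ℝ → ℂ} (hF : Measurable F) (k : ℕ) :
    Measurable (recordTerm F k) := by
  unfold recordTerm
  refine Measurable.ite ?_ (hF.comp (measurable_partialSum k)) measurable_const
  have : {v : ℕ → ℝ | ∀ j < k, partialSum v j < partialSum v k} =
      ⋂ j, ⋂ _ : j < k, {v | partialSum v j < partialSum v k} := by ext; simp
  rw [this]
  exact MeasurableSet.iInter fun j => MeasurableSet.iInter fun _ =>
    measurableSet_lt (measurable_partialSum j) (measurable_partialSum k)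

lemma measurable_nonposTerm {H : ℝ → ℂ} (hH : Measurable H) (m : ℕ) :
    Measurable (nonposTerm H m) := by
  unfold nonposTerm
  refine Measurable.ite ?_ (hH.comp (measurable_partialSum m)) measurable_const
  have : {v : ℕ → ℝ | ∀ j ≤ m, partialSum v j ≤ 0} =
      ⋂ j, ⋂ _ : j ≤ m, {v | partialSum v j ≤ 0} := by ext; simp
  rw [this]
  exact MeasurableSet.iInter fun j => MeasurableSet.iInter fun _ =>
    measurableSet_le (measurable_partialSum j) measurable_const

lemma norm_recordTerm_le {F : ℝ → ℂ} (hF : ∀ x, ‖F x‖ ≤ 1) (k : ℕ) (v : ℕ → ℝ) :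
    ‖recordTerm F k v‖ ≤ 1 := by
  unfold recordTerm; split_ifs
  · exact hF _
  · simp

lemma norm_nonposTerm_le {H : ℝ → ℂ} (hH : ∀ x, ‖H x‖ ≤ 1) (m : ℕ) (v : ℕ → ℝ) :
    ‖nonposTerm H m v‖ ≤ 1 := by
  unfold nonposTerm; split_ifs
  · exact hH _
  · simp

variable (μ : Measure ℝ) [IsProbabilityMeasure μ]

/-- The law of a sequence of independent variables of law `μ`. -/
abbrev iidLaw : Measure (ℕ → ℝ) := Measure.infinitePi fun _ => μ

lemma iidLaw_iIndepFun : iIndepFun (fun (i : ℕ) (v : ℕ → ℝ) => v i) (iidLaw μ) :=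
  iIndepFun_infinitePi (X := fun _ x => x) fun _ => measurable_id

lemma iidLaw_map_reindex {σ : ℕ → ℕ} (hσ : Function.Injective σ) :
    Measure.map (fun (v : ℕ → ℝ) i => v (σ i)) (iidLaw μ) = iidLaw μ := by
  rw [((iidLaw_iIndepFun μ).precomp hσ).map_fun_eq_infinitePi_map fun i => measurable_pi_apply _]
  congr 1
  funext i
  exact Measure.infinitePi_map_eval (fun _ => μ) (σ i)

lemma iidLaw_integral_reindex {σ : ℕ → ℕ} (hσ : Function.Injective σ) {Ψ : (ℕ → ℝ) → ℂ}
    (hΨ : Measurable Ψ) :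
    ∫ v, Ψ (fun i => v (σ i)) ∂(iidLaw μ) = ∫ v, Ψ v ∂(iidLaw μ) := by
  conv_rhs => rw [← iidLaw_map_reindex μ hσ]
  rw [integral_map]
  · exact (measurable_pi_lambda _ fun i => measurable_pi_apply _).aemeasurable
  · exact hΨ.aestronglyMeasurable

lemma integral_recordTerm_mul_nonposTerm {F H : ℝ → ℂ} (hF : Measurable F) (hH : Measurable H)
    (k m : ℕ) :
    ∫ v, recordTerm F k v * nonposTerm H m (fun i => v (k + i)) ∂(iidLaw μ) =
      (∫ v, recordTerm F k v ∂(iidLaw μ)) * ∫ v, nonposTerm H m v ∂(iidLaw μ) := by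
  classical
  have hind := (iidLaw_iIndepFun μ).indepFun_finset (Finset.range k) (Finset.Ico k (k + m))
    (by
      rw [Finset.disjoint_left]
      intro a ha hb
      simp only [Finset.mem_range, Finset.mem_Ico] at ha hb
      omega) (fun i => measurable_pi_apply i)
  have hmeas : ∀ S : Finset ℕ, Measurable fun (w : S → ℝ) (i : ℕ) =>
      if h : i ∈ S then w ⟨i, h⟩ else 0 := fun S => by
    refine measurable_pi_lambda _ fun i => ?_
    by_cases h : i ∈ S
    · simpa [h] using measurable_pi_apply _
    · simp [h]
  have h1 := hind.comp ((measurable_recordTerm hF k).comp (hmeas _))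
    ((measurable_nonposTerm hH m).comp ((measurable_pi_lambda (fun (v : ℕ → ℝ) i => v (k + i))
      fun i => measurable_pi_apply _).comp (hmeas _)))
  have e1 : ((recordTerm F k ∘ fun (w : Finset.range k → ℝ) (i : ℕ) =>
      if h : i ∈ Finset.range k then w ⟨i, h⟩ else 0) ∘ fun (v : ℕ → ℝ) i => v i) =
      recordTerm F k := by
    funext v
    exact recordTerm_congr F fun i hi => by simp [hi]
  have e2 : ((nonposTerm H m ∘ ((fun (v : ℕ → ℝ) i => v (k + i)) ∘
      fun (w : Finset.Ico k (k + m) → ℝ) (i : ℕ) =>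
      if h : i ∈ Finset.Ico k (k + m) then w ⟨i, h⟩ else 0)) ∘ fun (v : ℕ → ℝ) i => v i) =
      fun v => nonposTerm H m fun i => v (k + i) := by
    funext v
    exact nonposTerm_congr H fun i hi => by simp [hi]
  rw [e1, e2] at h1
  have hshift : Measurable fun (v : ℕ → ℝ) => nonposTerm H m fun i => v (k + i) :=
    (measurable_nonposTerm hH m).comp (measurable_pi_lambda _ fun i => measurable_pi_apply _)
  rw [h1.integral_fun_mul_eq_mul_integral (measurable_recordTerm hF k).aestronglyMeasurable
    hshift.aestronglyMeasurable,
    iidLaw_integral_reindex μ (add_right_injective k) (measurable_nonposTerm hH m)]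

lemma integral_walkMax_decomposition {F H : ℝ → ℂ} (hF : Measurable F) (hH : Measurable H)
    (hF1 : ∀ x, ‖F x‖ ≤ 1) (hH1 : ∀ x, ‖H x‖ ≤ 1) (n : ℕ) :
    ∫ v, F (walkMax v n) * H (partialSum v n - walkMax v n) ∂(iidLaw μ) =
      ∑ k ∈ Finset.range (n + 1), (∫ v, recordTerm F k v ∂(iidLaw μ)) *
        ∫ v, nonposTerm H (n - k) v ∂(iidLaw μ) := by
  simp_rw [walkMax_decomposition]
  rw [integral_finsetSum]
  · exact Finset.sum_congr rfl fun k _ => integral_recordTerm_mul_nonposTerm μ hF hH k _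
  · intro k _
    refine Integrable.of_bound (C := 1) (Measurable.aestronglyMeasurable ?_) (ae_of_all _ fun v => ?_)
    · exact (measurable_recordTerm hF k).mul
        ((measurable_nonposTerm hH _).comp (measurable_pi_lambda _ fun i => measurable_pi_apply _))
    · rw [norm_mul]
      exact mul_le_one₀ (norm_recordTerm_le hF1 k v) (norm_nonneg _) (norm_nonposTerm_le hH1 _ _)

lemma summable_norm_pow_mul {q : ℝ} (hq0 : 0 ≤ q) (hq1 : q < 1) {a : ℕ → ℂ}
    (ha : ∀ n, ‖a n‖ ≤ 1) : Summable fun n => ‖(q : ℂ) ^ n * a n‖ := by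
  refine Summable.of_nonneg_of_le (fun _ => norm_nonneg _) (fun n => ?_)
    (summable_geometric_of_lt_one hq0 hq1)
  rw [norm_mul, norm_pow, Complex.norm_real, Real.norm_of_nonneg hq0]
  exact mul_le_of_le_one_right (pow_nonneg hq0 n) (ha n)

lemma norm_integral_le_one {α : Type*} [MeasurableSpace α] (ρ : Measure α)
    [IsProbabilityMeasure ρ] {f : α → ℂ} (hf : ∀ x, ‖f x‖ ≤ 1) : ‖∫ x, f x ∂ρ‖ ≤ 1 := by
  simpa using norm_integral_le_of_norm_le_const (μ := ρ) (ae_of_all _ hf)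

lemma tsum_walkMax_factorization {F H : ℝ → ℂ} (hF : Measurable F) (hH : Measurable H)
    (hF1 : ∀ x, ‖F x‖ ≤ 1) (hH1 : ∀ x, ‖H x‖ ≤ 1) {q : ℝ} (hq0 : 0 ≤ q) (hq1 : q < 1) :
    ∑' n, (q : ℂ) ^ n * ∫ v, F (walkMax v n) * H (partialSum v n - walkMax v n) ∂(iidLaw μ) =
      (∑' n, (q : ℂ) ^ n * ∫ v, recordTerm F n v ∂(iidLaw μ)) *
        ∑' n, (q : ℂ) ^ n * ∫ v, nonposTerm H n v ∂(iidLaw μ) := by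
  rw [tsum_mul_tsum_eq_tsum_sum_range_of_summable_norm
    (summable_norm_pow_mul hq0 hq1 fun n => norm_integral_le_one _ (norm_recordTerm_le hF1 n))
    (summable_norm_pow_mul hq0 hq1 fun n => norm_integral_le_one _ (norm_nonposTerm_le hH1 n))]
  refine tsum_congr fun n => ?_
  rw [integral_walkMax_decomposition μ hF hH hF1 hH1, Finset.mul_sum]
  refine Finset.sum_congr rfl fun k hk => ?_
  have : (q : ℂ) ^ n = q ^ k * q ^ (n - k) := by
    rw [← pow_add, Nat.add_sub_cancel' (by simpa [Nat.lt_succ_iff] using hk)]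
  rw [this]
  ring

/-- The character `x ↦ exp (i θ x)`. -/
def character (θ x : ℝ) : ℂ := Complex.exp (θ * x * Complex.I)

lemma continuous_character (θ : ℝ) : Continuous (character θ) := by
  unfold character; fun_prop

lemma norm_character (θ x : ℝ) : ‖character θ x‖ = 1 := by
  unfold character
  rw [← Complex.ofReal_mul, Complex.norm_exp_ofReal_mul_I]

lemma character_add (θ x y : ℝ) : character θ (x + y) = character θ x * character θ y := by
  unfold character
  rw [← Complex.exp_add]
  push_cast
  ring_nf

/-- Wiener–Hopf factorization of a random walk at an independent geometric time. -/
lemma randomWalk_wienerHopf (θ : ℝ) {q : ℝ} (hq0 : 0 ≤ q) (hq1 : q < 1) :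
    (∑' n, (q : ℂ) ^ n * ∫ v, character θ (partialSum v n) ∂(iidLaw μ)) * ∑' n, (q : ℂ) ^ n =
      (∑' n, (q : ℂ) ^ n * ∫ v, character θ (walkMax v n) ∂(iidLaw μ)) *
        ∑' n, (q : ℂ) ^ n * ∫ v, character θ (-walkMax (fun i => -v i) n) ∂(iidLaw μ) := by
  have hc := (continuous_character θ).measurable
  have hc1 : ∀ x, ‖character θ x‖ ≤ 1 := fun x => (norm_character θ x).le
  have h1 : Measurable fun _ : ℝ => (1 : ℂ) := measurable_const
  have h11 : ∀ x : ℝ, ‖(fun _ : ℝ => (1 : ℂ)) x‖ ≤ 1 := by simp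
  have hA := tsum_walkMax_factorization μ hc hc hc1 hc1 hq0 hq1
  have hB := tsum_walkMax_factorization μ h1 h1 h11 h11 hq0 hq1
  have hC := tsum_walkMax_factorization μ hc h1 hc1 h11 hq0 hq1
  have hD := tsum_walkMax_factorization μ h1 hc h11 hc1 hq0 hq1
  simp only [← character_add, add_sub_cancel, mul_one, one_mul, integral_const, probReal_univ,
    one_smul] at hA hB hC hD
  have hrev : ∀ n, ∫ v, character θ (-walkMax (fun i => -v i) n) ∂(iidLaw μ) =
      ∫ v, character θ (partialSum v n - walkMax v n) ∂(iidLaw μ) := fun n => by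
    rw [← iidLaw_integral_reindex μ (reverseIndex_injective n)
      (Ψ := fun v => character θ (-walkMax (fun i => -v i) n))]
    · simp_rw [neg_walkMax_neg_reverse]
    · exact hc.comp ((measurable_walkMax n).comp
        (measurable_pi_lambda _ fun i => (measurable_pi_apply i).neg)).neg
  simp_rw [hrev]
  rw [hA, hB, hC, hD]
  ring

end RandomWalk

section Path

/-- Maximum of a path over the grid points `0, h, …, n h`. -/
def gridMax (p : ℝ → ℝ) (h : ℝ) (n : ℕ) : ℝ :=
  (Finset.range (n + 1)).sup' Finset.nonempty_range_add_one fun k => p (k * h)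

lemma bddAbove_image_Icc_of_cadlag {p : ℝ → ℝ}
    (hrc : ∀ t, ContinuousWithinAt p (Ici t) t)
    (hll : ∀ t, ∃ L, Tendsto p (nhdsWithin t (Iio t)) (nhds L)) (a b : ℝ) :
    BddAbove (p '' Icc a b) := by
  refine isCompact_Icc.induction_on (p := fun s => BddAbove (p '' s)) (by simp)
    (fun s t hst ht => ht.mono (image_mono hst))
    (fun s t hs ht => by rw [image_union]; exact hs.union ht) fun x _ => ?_
  obtain ⟨L, hL⟩ := hll x
  have h1 : ∀ᶠ s in nhdsWithin x (Iio x), p s < L + 1 := hL.eventually_lt_const (by linarith)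
  have h2 : ∀ᶠ s in nhdsWithin x (Ici x), p s < p x + 1 :=
    (hrc x).eventually_lt_const (by linarith)
  refine ⟨{s | p s ≤ max (L + 1) (p x + 1)}, mem_nhdsWithin_of_mem_nhds ?_,
    ⟨max (L + 1) (p x + 1), by rintro _ ⟨s, hs, rfl⟩; exact hs⟩⟩
  rw [← nhdsWithin_univ, ← Iio_union_Ici (a := x), nhdsWithin_union]
  exact ⟨h1.mono fun s hs => hs.le.trans (le_max_left _ _),
    h2.mono fun s hs => hs.le.trans (le_max_right _ _)⟩

lemma bddBelow_image_Icc_of_cadlag {p : ℝ → ℝ}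
    (hrc : ∀ t, ContinuousWithinAt p (Ici t) t)
    (hll : ∀ t, ∃ L, Tendsto p (nhdsWithin t (Iio t)) (nhds L)) (a b : ℝ) :
    BddBelow (p '' Icc a b) := by
  obtain ⟨C, hC⟩ := bddAbove_image_Icc_of_cadlag (p := fun s => -p s) (fun t => (hrc t).neg)
    (fun t => (hll t).elim fun L hL => ⟨-L, hL.neg⟩) a b
  refine ⟨-C, ?_⟩
  rintro _ ⟨s, hs, rfl⟩
  linarith [hC ⟨s, hs, rfl⟩]

/-- The mesh `1 / (m + 1)`. -/
def mesh (m : ℕ) : ℝ := 1 / ((m : ℝ) + 1)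

lemma mesh_pos (m : ℕ) : 0 < mesh m := Nat.one_div_pos_of_nat

lemma tendsto_mesh : Tendsto mesh atTop (nhds 0) := tendsto_one_div_add_atTop_nhds_zero_nat

lemma lt_succ_floor_mul {h : ℝ} (hh : 0 < h) (t : ℝ) :
    t < ((⌊t / h⌋₊ + 1 : ℕ) : ℝ) * h := by
  have := Nat.lt_floor_add_one (t / h)
  rw [div_lt_iff₀ hh] at this
  exact_mod_cast this

lemma succ_floor_mul_le {h : ℝ} (hh : 0 < h) {t : ℝ} (ht : 0 ≤ t) :
    ((⌊t / h⌋₊ + 1 : ℕ) : ℝ) * h ≤ t + h := by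
  have := Nat.floor_le (div_nonneg ht hh.le)
  rw [le_div_iff₀ hh] at this
  push_cast
  linarith

lemma tendsto_succ_floor_mul {t : ℝ} (ht : 0 ≤ t) :
    Tendsto (fun m => ((⌊t / mesh m⌋₊ + 1 : ℕ) : ℝ) * mesh m) atTop (nhdsWithin t (Ici t)) := by
  refine tendsto_nhdsWithin_iff.2 ⟨?_, Eventually.of_forall fun m =>
    (lt_succ_floor_mul (mesh_pos m) t).le⟩
  refine tendsto_of_tendsto_of_tendsto_of_le_of_le tendsto_const_nhds
    (by simpa using tendsto_mesh.const_add t)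
    (fun m => (lt_succ_floor_mul (mesh_pos m) t).le)
    (fun m => succ_floor_mul_le (mesh_pos m) ht)

lemma tendsto_gridMax {p : ℝ → ℝ} (hrc : ∀ t, ContinuousWithinAt p (Ici t) t) {t : ℝ}
    (ht : 0 ≤ t) (hbdd : BddAbove (p '' Icc 0 t)) :
    Tendsto (fun m => gridMax p (mesh m) (⌊t / mesh m⌋₊ + 1)) atTop
      (nhds (sSup (p '' Icc 0 t))) := by
  have hle : ∀ s ∈ Icc 0 t, p s ≤ sSup (p '' Icc 0 t) := fun s hs =>
    le_csSup hbdd (mem_image_of_mem p hs)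
  refine tendsto_order.2 ⟨fun a ha => ?_, fun b hb => ?_⟩
  · obtain ⟨_, ⟨s, hs, rfl⟩, hlt⟩ :=
      exists_lt_of_lt_csSup ((nonempty_Icc.2 ht).image p) ha
    filter_upwards [((hrc s).tendsto.comp (tendsto_succ_floor_mul hs.1)).eventually_const_lt hlt]
      with m hm
    refine hm.trans_le (Finset.le_sup' (fun k : ℕ => p (k * mesh m)) (Finset.mem_range.2 ?_))
    have := Nat.floor_le_floor (div_le_div_of_nonneg_right hs.2 (mesh_pos m).le)
    omega
  · filter_upwards [((hrc t).tendsto.comp (tendsto_succ_floor_mul ht)).eventually_lt_const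
      ((hle t ⟨ht, le_rfl⟩).trans_lt hb)] with m hm
    refine (Finset.sup'_lt_iff _).2 fun k hk => ?_
    rcases (Nat.lt_succ_iff.1 (Finset.mem_range.1 hk)).eq_or_lt with h | h
    · rw [h]; exact hm
    · refine (hle _ ⟨mul_nonneg k.cast_nonneg (mesh_pos m).le, ?_⟩).trans_lt hb
      have h1 : (k : ℝ) ≤ ⌊t / mesh m⌋₊ := by exact_mod_cast Nat.lt_succ_iff.1 h
      have h2 := h1.trans (Nat.floor_le (div_nonneg ht (mesh_pos m).le))
      rwa [le_div_iff₀ (mesh_pos m)] at h2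

end Path

section ExponentialTime

/-- The exponential law of rate `r`. -/
def expLaw (r : ℝ) : Measure ℝ :=
  ((volume : Measure ℝ).restrict (Ici 0)).withDensity
    fun t => ENNReal.ofReal (r * Real.exp (-r * t))

lemma measurable_expDensity (r : ℝ) :
    Measurable fun t : ℝ => ENNReal.ofReal (r * Real.exp (-r * t)) := by fun_prop

lemma integrableOn_expDensity {r : ℝ} (hr : 0 < r) :
    IntegrableOn (fun t : ℝ => r * Real.exp (-r * t)) (Ici 0) := by
  rw [integrableOn_Ici_iff_integrableOn_Ioi]
  exact (exp_neg_integrableOn_Ioi 0 hr).const_mul r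

lemma expLaw_Ici {r : ℝ} (hr : 0 < r) {a : ℝ} (ha : 0 ≤ a) :
    expLaw r (Ici a) = ENNReal.ofReal (Real.exp (-r * a)) := by
  have hsub : Ici a ⊆ Ici (0 : ℝ) := Ici_subset_Ici.2 ha
  rw [expLaw, withDensity_apply _ measurableSet_Ici, Measure.restrict_restrict measurableSet_Ici,
    inter_eq_left.2 hsub, ← ofReal_integral_eq_lintegral_ofReal
      ((integrableOn_expDensity hr).mono_set hsub)
      (ae_of_all _ fun t => mul_nonneg hr.le (Real.exp_pos _).le), integral_Ici_eq_integral_Ioi,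
    integral_const_mul, integral_exp_mul_Ioi (by linarith)]
  congr 1
  field_simp

lemma expLaw_isProbabilityMeasure {r : ℝ} (hr : 0 < r) : IsProbabilityMeasure (expLaw r) := by
  refine ⟨?_⟩
  have h : expLaw r (Ici 0)ᶜ = 0 := by
    refine withDensity_absolutelyContinuous _ _ ?_
    rw [Measure.restrict_apply measurableSet_Ici.compl]
    rw [compl_inter_self, measure_empty]
  rw [← measure_add_measure_compl (measurableSet_Ici (a := (0 : ℝ))), h, expLaw_Ici hr le_rfl]
  simp

lemma ae_expLaw_nonneg (r : ℝ) : ∀ᵐ t ∂(expLaw r), 0 ≤ t :=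
  withDensity_absolutelyContinuous _ _ (ae_restrict_mem measurableSet_Ici)

lemma expLaw_real_floor {r h : ℝ} (hr : 0 < r) (hh : 0 < h) (n : ℕ) :
    ((expLaw r).map fun t => ⌊t / h⌋₊).real {n} =
      (1 - Real.exp (-r * h)) * Real.exp (-r * h) ^ n := by
  have := expLaw_isProbabilityMeasure hr
  have hmeas : Measurable fun t : ℝ => ⌊t / h⌋₊ := Nat.measurable_floor.comp (by fun_prop)
  have hset : (fun t : ℝ => ⌊t / h⌋₊) ⁻¹' {n} =ᵐ[expLaw r]
      (Ici (n * h) \ Ici ((n + 1) * h) : Set ℝ) := by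
    filter_upwards [ae_expLaw_nonneg r] with t ht
    refine propext ?_
    change ⌊t / h⌋₊ = n ↔ (n * h ≤ t ∧ ¬ ((n + 1) * h ≤ t))
    rw [Nat.floor_eq_iff (div_nonneg ht hh.le), le_div_iff₀ hh, div_lt_iff₀ hh, not_le]
  have hn : (0 : ℝ) ≤ n * h := by positivity
  have hn1 : (0 : ℝ) ≤ (n + 1) * h := by positivity
  rw [Measure.real, Measure.map_apply hmeas (measurableSet_singleton n), measure_congr hset,
    ← Measure.real, measureReal_sdiff (Ici_subset_Ici.2 (by nlinarith)) measurableSet_Ici,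
    Measure.real, Measure.real, expLaw_Ici hr hn, expLaw_Ici hr hn1,
    ENNReal.toReal_ofReal (Real.exp_pos _).le, ENNReal.toReal_ofReal (Real.exp_pos _).le,
    ← Real.exp_nat_mul, one_sub_mul, ← Real.exp_add]
  ring_nf

/-- Geometric averages as averages over a discretized exponential time. -/
lemma geometric_tsum_eq {r h : ℝ} (hr : 0 < r) (hh : 0 < h) {a : ℕ → ℂ} (ha : ∀ n, ‖a n‖ ≤ 1) :
    (1 - (Real.exp (-r * h) : ℂ)) * ∑' n, (Real.exp (-r * h) : ℂ) ^ n * a n =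
      (1 - (Real.exp (-r * h) : ℂ)) * a 0 +
        (Real.exp (-r * h) : ℂ) * ∫ t, a (⌊t / h⌋₊ + 1) ∂(expLaw r) := by
  have := expLaw_isProbabilityMeasure hr
  have hmeas : Measurable fun t : ℝ => ⌊t / h⌋₊ := Nat.measurable_floor.comp (by fun_prop)
  have := Measure.isProbabilityMeasure_map (μ := expLaw r) hmeas.aemeasurable
  have hint : ∫ t, a (⌊t / h⌋₊ + 1) ∂(expLaw r) =
      ∑' n, (1 - (Real.exp (-r * h) : ℂ)) * ((Real.exp (-r * h) : ℂ) ^ n * a (n + 1)) := by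
    rw [← integral_map (φ := fun t : ℝ => ⌊t / h⌋₊) (f := fun n => a (n + 1))
      hmeas.aemeasurable (measurable_of_countable _).aestronglyMeasurable, integral_countable]
    · refine tsum_congr fun n => ?_
      rw [expLaw_real_floor hr hh, Complex.real_smul]
      push_cast
      ring
    · exact Integrable.of_bound (measurable_of_countable _).aestronglyMeasurable 1
        (ae_of_all _ fun n => ha _)
  have hq1 : Real.exp (-r * h) < 1 := Real.exp_lt_one_iff.2 (by nlinarith)
  rw [hint, tsum_mul_left,
    (summable_norm_pow_mul (Real.exp_pos _).le hq1 ha).of_norm.tsum_eq_zero_add]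
  simp_rw [pow_succ' (Real.exp (-r * h) : ℂ), mul_assoc]
  rw [tsum_mul_left, pow_zero]
  ring

end ExponentialTime

section LevyProcess

open ProbabilityTheory

variable {Ω : Type*} [MeasurableSpace Ω] (P : Measure Ω) [IsProbabilityMeasure P]

lemma tendsto_geometric_tsum {r : ℝ} (hr : 0 < r) (θ : ℝ) {Z : ℕ → ℕ → Ω → ℝ} {W : ℝ → Ω → ℝ}
    (hZ : ∀ m n, Measurable (Z m n))
    (hW : ∀ ω t, 0 ≤ t → Tendsto (fun m => Z m (⌊t / mesh m⌋₊ + 1) ω) atTop (nhds (W t ω))) :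
    AEMeasurable (fun z : ℝ × Ω => W z.1 z.2) ((expLaw r).prod P) ∧
    Tendsto (fun m => (1 - (Real.exp (-r * mesh m) : ℂ)) *
        ∑' n, (Real.exp (-r * mesh m) : ℂ) ^ n * ∫ ω, character θ (Z m n ω) ∂P) atTop
      (nhds (charFun (((expLaw r).prod P).map fun z : ℝ × Ω => W z.1 z.2) θ)) := by
  have := expLaw_isProbabilityMeasure hr
  have hc := continuous_character θ
  have hZm : ∀ m, Measurable fun z : ℝ × Ω => Z m (⌊z.1 / mesh m⌋₊ + 1) z.2 := fun m => by
    have h1 : Measurable fun z : ℕ × Ω => Z m z.1 z.2 :=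
      measurable_from_prod_countable_right fun n => hZ m n
    exact h1.comp (((measurable_of_countable fun n : ℕ => n + 1).comp
      (Nat.measurable_floor.comp (measurable_fst.div_const _))).prodMk measurable_snd)
  have hae : ∀ᵐ z : ℝ × Ω ∂((expLaw r).prod P), 0 ≤ z.1 :=
    Measure.quasiMeasurePreserving_fst.ae (ae_expLaw_nonneg r)
  have hWm : AEMeasurable (fun z : ℝ × Ω => W z.1 z.2) ((expLaw r).prod P) :=
    aemeasurable_of_tendsto_metrizable_ae atTop (fun m => (hZm m).aemeasurable)
      (hae.mono fun z hz => hW z.2 z.1 hz)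
  refine ⟨hWm, ?_⟩
  have hq : Tendsto (fun m => (Real.exp (-r * mesh m) : ℂ)) atTop (nhds 1) := by
    have h1 : Tendsto (fun m => Real.exp (-r * mesh m)) atTop (nhds 1) := by
      have := (Real.continuous_exp.tendsto _).comp (tendsto_mesh.const_mul (-r))
      rwa [mul_zero, Real.exp_zero] at this
    exact_mod_cast (Complex.continuous_ofReal.tendsto 1).comp h1
  have hbd : ∀ m n, ‖∫ ω, character θ (Z m n ω) ∂P‖ ≤ 1 := fun m n =>
    norm_integral_le_one P fun ω => (norm_character θ _).le
  have hlim : Tendsto (fun m => ∫ t, (∫ ω, character θ (Z m (⌊t / mesh m⌋₊ + 1) ω) ∂P) ∂(expLaw r))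
      atTop (nhds (∫ z, character θ (W z.1 z.2) ∂((expLaw r).prod P))) := by
    have hint : ∀ m, ∫ t, (∫ ω, character θ (Z m (⌊t / mesh m⌋₊ + 1) ω) ∂P) ∂(expLaw r) =
        ∫ z : ℝ × Ω, character θ (Z m (⌊z.1 / mesh m⌋₊ + 1) z.2) ∂((expLaw r).prod P) := fun m => by
      rw [integral_prod]
      exact Integrable.of_bound (hc.measurable.comp (hZm m)).aestronglyMeasurable 1
        (ae_of_all _ fun z => (norm_character θ _).le)
    simp_rw [hint]
    exact tendsto_integral_of_dominated_convergence (fun _ => 1)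
      (fun m => (hc.measurable.comp (hZm m)).aestronglyMeasurable) (integrable_const _)
      (fun m => ae_of_all _ fun z => (norm_character θ _).le)
      (hae.mono fun z hz => (hc.tendsto _).comp (hW z.2 z.1 hz))
  have hchar : charFun (((expLaw r).prod P).map fun z : ℝ × Ω => W z.1 z.2) θ =
      ∫ z, character θ (W z.1 z.2) ∂((expLaw r).prod P) := by
    rw [charFun_apply_real]
    exact integral_map hWm (f := character θ) hc.aestronglyMeasurable
  simp_rw [geometric_tsum_eq hr (mesh_pos _) (hbd _)]
  rw [hchar]
  have h0 : Tendsto (fun m => (1 - (Real.exp (-r * mesh m) : ℂ)) *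
      ∫ ω, character θ (Z m 0 ω) ∂P) atTop (nhds 0) := by
    refine squeeze_zero_norm (a := fun m => ‖1 - (Real.exp (-r * mesh m) : ℂ)‖) (fun m => ?_) ?_
    · rw [norm_mul]
      exact mul_le_of_le_one_right (norm_nonneg _) (hbd m 0)
    · simpa using (hq.const_sub 1).norm
  simpa using h0.add (hq.mul hlim)

variable {X : ℝ → Ω → ℝ}

lemma iIndepFun_gridIncrements (hXsm : ∀ t, StronglyMeasurable (X t))
    (hindep : ∀ s t : ℝ, 0 ≤ s → s ≤ t →
      Indep (MeasurableSpace.comap (fun ω => X t ω - X s ω) inferInstance)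
        ((Filtration.natural X hXsm) s) P)
    {h : ℝ} (hh : 0 < h) :
    iIndepFun (fun (i : ℕ) ω => X ((i + 1) * h) ω - X (i * h) ω) P := by
  rw [iIndepFun_iff_measure_inter_preimage_eq_mul]
  intro S
  induction S using Finset.induction_on_max with
  | empty => simp
  | insert a s hlt ih =>
    intro sets hsets
    have ha : a ∉ s := fun h => lt_irrefl _ (hlt a h)
    rw [Finset.prod_insert ha, Finset.set_biInter_insert,
      ← ih fun i hi => hsets i (Finset.mem_insert_of_mem hi)]
    refine (Indep_iff _ _ P).1 (hindep (a * h) ((a + 1) * h) (by positivity) (by nlinarith)) _ _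
      ⟨_, hsets a (Finset.mem_insert_self _ _), rfl⟩ (Finset.measurableSet_biInter _ fun i hi => ?_)
    have hia : (i : ℝ) + 1 ≤ a := by exact_mod_cast hlt i hi
    have hm : ∀ u ≤ (a : ℝ) * h, Measurable[(Filtration.natural X hXsm) (a * h)] (X u) :=
      fun u hu => (((Filtration.stronglyAdapted_natural hXsm) u).mono
        ((Filtration.natural X hXsm).mono hu)).measurable
    exact ((hm _ (by nlinarith)).sub (hm _ (by nlinarith)))
      (hsets i (Finset.mem_insert_of_mem hi))

lemma map_gridIncrements (hXsm : ∀ t, StronglyMeasurable (X t))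
    (hstat : ∀ s t : ℝ, 0 ≤ s → s ≤ t →
      Measure.map (fun ω => X t ω - X s ω) P = Measure.map (X (t - s)) P)
    (hindep : ∀ s t : ℝ, 0 ≤ s → s ≤ t →
      Indep (MeasurableSpace.comap (fun ω => X t ω - X s ω) inferInstance)
        ((Filtration.natural X hXsm) s) P)
    {h : ℝ} (hh : 0 < h) :
    P.map (fun ω (i : ℕ) => X ((i + 1) * h) ω - X (i * h) ω) = iidLaw (P.map (X h)) := by
  have := Measure.isProbabilityMeasure_map (μ := P) (hXsm h).measurable.aemeasurable
  refine ((iIndepFun_gridIncrements P hXsm hindep hh).map_fun_eq_infinitePi_map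
    fun i => (hXsm _).measurable.sub (hXsm _).measurable).trans ?_
  congr 1
  funext i
  refine (hstat (i * h) ((i + 1) * h) (by positivity) (by nlinarith)).trans ?_
  rw [show ((i : ℝ) + 1) * h - i * h = h by ring]

lemma partialSum_gridIncrements (p : ℝ → ℝ) (h : ℝ) (hp : p 0 = 0) (n : ℕ) :
    partialSum (fun i => p ((i + 1) * h) - p (i * h)) n = p (n * h) := by
  have := Finset.sum_range_sub (fun i : ℕ => p (i * h)) n
  simpa [partialSum, hp] using this

lemma walkMax_gridIncrements (p : ℝ → ℝ) (h : ℝ) (hp : p 0 = 0) (n : ℕ) :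
    walkMax (fun i => p ((i + 1) * h) - p (i * h)) n = gridMax p h n :=
  Finset.sup'_congr _ rfl fun k _ => partialSum_gridIncrements p h hp k

/-- Wiener–Hopf factorization: at an independent exponential time, a process with stationary
independent increments is distributed as the sum of independent copies of its running supremum
and of its running infimum. -/
theorem wienerHopf
    (hXsm : ∀ t, StronglyMeasurable (X t))
    (hX0 : ∀ᵐ ω ∂P, X 0 ω = 0)
    (hXrc : ∀ ω t, ContinuousWithinAt (fun s => X s ω) (Ici t) t)
    (hXll : ∀ ω t, ∃ L, Tendsto (fun s => X s ω) (nhdsWithin t (Iio t)) (nhds L))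
    (hstat : ∀ s t : ℝ, 0 ≤ s → s ≤ t →
      Measure.map (fun ω => X t ω - X s ω) P = Measure.map (X (t - s)) P)
    (hindep : ∀ s t : ℝ, 0 ≤ s → s ≤ t →
      Indep (MeasurableSpace.comap (fun ω => X t ω - X s ω) inferInstance)
        ((Filtration.natural X hXsm) s) P)
    {r : ℝ} (hr : 0 < r) :
    AEMeasurable (fun z : ℝ × Ω => runSup X z.1 z.2) ((expLaw r).prod P) ∧
    AEMeasurable (fun z : ℝ × Ω => runInf X z.1 z.2) ((expLaw r).prod P) ∧
    ((expLaw r).prod P).map (fun z : ℝ × Ω => X z.1 z.2) =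
      (((expLaw r).prod P).map fun z : ℝ × Ω => runSup X z.1 z.2) ∗
        (((expLaw r).prod P).map fun z : ℝ × Ω => runInf X z.1 z.2) := by
  have := expLaw_isProbabilityMeasure hr
  have hgrid : ∀ (Y : ℝ → Ω → ℝ) (_ : ∀ t, Measurable (Y t)) (h : ℝ) (n : ℕ),
      Measurable fun ω => gridMax (fun s => Y s ω) h n := fun Y hY h n =>
    Finset.measurable_range_sup'' fun k _ => hY _
  have hXm : ∀ t, Measurable (X t) := fun t => (hXsm t).measurable
  have hXs := fun θ => tendsto_geometric_tsum P hr θ (Z := fun m n ω => X (n * mesh m) ω) (W := X)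
    (fun m n => hXm _) fun ω t ht => (hXrc ω t).tendsto.comp (tendsto_succ_floor_mul ht)
  have hMs := fun θ => tendsto_geometric_tsum P hr θ
    (Z := fun m n ω => gridMax (fun s => X s ω) (mesh m) n) (W := runSup X)
    (fun m n => hgrid X hXm _ _) fun ω t ht =>
      tendsto_gridMax (hXrc ω) ht (bddAbove_image_Icc_of_cadlag (hXrc ω) (hXll ω) 0 t)
  have hIs := fun θ => tendsto_geometric_tsum P hr θ
    (Z := fun m n ω => -gridMax (fun s => -X s ω) (mesh m) n) (W := runInf X)
    (fun m n => (hgrid (fun s ω => -X s ω) (fun t => (hXm t).neg) _ _).neg) fun ω t ht => by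
      have hrc : ∀ t, ContinuousWithinAt (fun s => -X s ω) (Ici t) t := fun t => (hXrc ω t).neg
      have hll : ∀ t, ∃ L, Tendsto (fun s => -X s ω) (nhdsWithin t (Iio t)) (nhds L) :=
        fun t => let ⟨L, hL⟩ := hXll ω t; ⟨-L, hL.neg⟩
      have := (tendsto_gridMax hrc ht (bddAbove_image_Icc_of_cadlag hrc hll 0 t)).neg
      rwa [← image_image Neg.neg, image_neg_eq_neg, Real.sSup_neg, neg_neg] at this
  refine ⟨(hMs 0).1, (hIs 0).1, ?_⟩
  have := Measure.isProbabilityMeasure_map (hXs 0).1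
  have := Measure.isProbabilityMeasure_map (hMs 0).1
  have := Measure.isProbabilityMeasure_map (hIs 0).1
  refine Measure.ext_of_charFun (funext fun θ => ?_)
  rw [charFun_conv]
  refine tendsto_nhds_unique (hXs θ).2 (((hMs θ).2.mul (hIs θ).2).congr fun m => ?_)
  have hh := mesh_pos m
  set q := Real.exp (-r * mesh m) with hqdef
  have hq1 : q < 1 := Real.exp_lt_one_iff.2 (by nlinarith)
  have hqc : (1 : ℂ) - q ≠ 0 := by
    rw [sub_ne_zero]
    exact_mod_cast hq1.ne'
  have := Measure.isProbabilityMeasure_map (μ := P) (hXm (mesh m)).aemeasurable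
  have hincr : Measurable fun ω (i : ℕ) => X ((i + 1) * mesh m) ω - X (i * mesh m) ω :=
    measurable_pi_lambda _ fun i => (hXm _).sub (hXm _)
  have hc := continuous_character θ
  have transfer : ∀ (Ψ : (ℕ → ℝ) → ℝ) (_ : Measurable Ψ) (Z : Ω → ℝ)
      (_ : ∀ ω, X 0 ω = 0 → Ψ (fun i => X ((i + 1) * mesh m) ω - X (i * mesh m) ω) = Z ω),
      ∫ v, character θ (Ψ v) ∂(iidLaw (P.map (X (mesh m)))) = ∫ ω, character θ (Z ω) ∂P := by
    intro Ψ hΨ Z hZ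
    rw [← map_gridIncrements P hXsm hstat hindep hh, integral_map hincr.aemeasurable
      (f := fun v => character θ (Ψ v)) (hc.measurable.comp hΨ).aestronglyMeasurable]
    exact integral_congr_ae (hX0.mono fun ω hω => by simp only [hZ ω hω])
  have key := randomWalk_wienerHopf (P.map (X (mesh m))) θ (Real.exp_pos _).le hq1
  rw [← hqdef] at key
  simp_rw [fun n => transfer (fun v => partialSum v n) (measurable_partialSum n)
      (fun ω => X (n * mesh m) ω)
      (fun ω hω => partialSum_gridIncrements (fun s => X s ω) _ hω n),
    fun n => transfer (fun v => walkMax v n) (measurable_walkMax n)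
      (fun ω => gridMax (fun s => X s ω) (mesh m) n)
      (fun ω hω => walkMax_gridIncrements (fun s => X s ω) _ hω n),
    fun n => transfer (fun v => -walkMax (fun i => -v i) n)
      ((measurable_walkMax n).comp
        (measurable_pi_lambda _ fun i => (measurable_pi_apply i).neg)).neg
      (fun ω => -gridMax (fun s => -X s ω) (mesh m) n)
      (fun ω hω => by
        rw [← walkMax_gridIncrements (fun s => -X s ω) _ (by simpa using hω) n]
        simp only [neg_sub, neg_sub_neg])] at key
  rw [tsum_geometric_of_norm_lt_one (by
    rwa [Complex.norm_real, Real.norm_of_nonneg (Real.exp_pos _).le])] at key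
  rw [mul_mul_mul_comm, ← key, mul_mul_mul_comm, mul_inv_cancel₀ hqc, mul_one]

end LevyProcess

section Representation

variable {Ω : Type*} [MeasurableSpace Ω] (P : Measure Ω) [IsProbabilityMeasure P]

lemma integral_expLaw {r : ℝ} (hr : 0 < r) (f : ℝ → ℝ) :
    ∫ t, f t ∂(expLaw r) = ∫ t in Ici (0 : ℝ), f t * (r * Real.exp (-r * t)) := by
  rw [expLaw, integral_withDensity_eq_integral_toReal_smul (measurable_expDensity r)
    (ae_of_all _ fun _ => ENNReal.ofReal_lt_top)]
  refine integral_congr_ae (ae_of_all _ fun t => ?_)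
  simp only [ENNReal.toReal_ofReal (mul_nonneg hr.le (Real.exp_pos (-r * t)).le), smul_eq_mul]
  ring

lemma setIntegral_mul_exp {r : ℝ} (hr : 0 < r) (f : ℝ → ℝ) :
    ∫ t in Ici (0 : ℝ), f t * Real.exp (-r * t) = r⁻¹ * ∫ t, f t ∂(expLaw r) := by
  rw [integral_expLaw hr, ← integral_const_mul]
  refine integral_congr_ae (ae_of_all _ fun t => ?_)
  field_simp

lemma integrable_expLaw_prod {r : ℝ} (hr : 0 < r) {f : ℝ × Ω → ℝ}
    (hf : Integrable (fun p => f p * Real.exp (-r * p.1))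
      (((volume : Measure ℝ).restrict (Ici 0)).prod P)) :
    Integrable f ((expLaw r).prod P) := by
  have hm : Measurable fun z : ℝ × Ω => ENNReal.ofReal (r * Real.exp (-r * z.1)) := by fun_prop
  rw [expLaw, prod_withDensity_left (measurable_expDensity r),
    integrable_withDensity_iff_integrable_smul' hm
      (ae_of_all _ fun _ => ENNReal.ofReal_lt_top)]
  refine (hf.const_mul r).congr (ae_of_all _ fun p => ?_)
  simp only [ENNReal.toReal_ofReal (mul_nonneg hr.le (Real.exp_pos (-r * p.1)).le), smul_eq_mul]
  ring

/-- On every interval, `|g|` is bounded by the sum of its values at the endpoints. -/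
def EndpointDominated (g : ℝ → ℝ) : Prop :=
  ∀ a b z, a ≤ z → z ≤ b → |g z| ≤ |g a| + |g b|

lemma Monotone.endpointDominated {g : ℝ → ℝ} (hg : Monotone g) : EndpointDominated g :=
  fun _ _ _ ha hb => (abs_le_max_abs_abs (hg ha) (hg hb)).trans
    (max_le_add_of_nonneg (abs_nonneg _) (abs_nonneg _))

lemma Antitone.endpointDominated {g : ℝ → ℝ} (hg : Antitone g) : EndpointDominated g :=
  fun _ _ _ ha hb => (abs_le_max_abs_abs (hg hb) (hg ha)).trans
    ((max_le_add_of_nonneg (abs_nonneg _) (abs_nonneg _)).trans (add_comm _ _).le)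

lemma continuous_integral_translate {ν : Measure ℝ} {g : ℝ → ℝ} (hg : Continuous g)
    (hdom : EndpointDominated g) (hint : ∀ y, Integrable (fun z => g (y + z)) ν) :
    Continuous fun y => ∫ z, g (y + z) ∂ν := by
  refine continuous_iff_continuousAt.2 fun y₀ => ?_
  refine continuousAt_of_dominated
    (bound := fun z => |g (y₀ - 1 + z)| + |g (y₀ + 1 + z)|)
    (Eventually.of_forall fun y => (hint y).aestronglyMeasurable) ?_
    ((hint _).abs.add (hint _).abs) (ae_of_all _ fun z => by fun_prop)
  filter_upwards [Icc_mem_nhds (sub_one_lt y₀) (lt_add_one y₀)] with y hy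
  exact ae_of_all _ fun z => hdom _ _ _ (by linarith [hy.1]) (by linarith [hy.2])

/-- If `X` at an independent exponential time is distributed as the sum of independent copies of
`A` and `B` at this time, then the discounted reward along `X` is the average along `A` of the
discounted reward along `B`. -/
lemma representation_of_factorization {r : ℝ} (hr : 0 < r) {g : ℝ → ℝ} (hg : Continuous g)
    (hdom : EndpointDominated g) {X A B : ℝ → Ω → ℝ}
    (hX : Measurable (Function.uncurry X))
    (hA : AEMeasurable (fun z : ℝ × Ω => A z.1 z.2) ((expLaw r).prod P))
    (hB : AEMeasurable (fun z : ℝ × Ω => B z.1 z.2) ((expLaw r).prod P))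
    (hlaw : ((expLaw r).prod P).map (fun z : ℝ × Ω => X z.1 z.2) =
      (((expLaw r).prod P).map fun z : ℝ × Ω => A z.1 z.2) ∗
        (((expLaw r).prod P).map fun z : ℝ × Ω => B z.1 z.2))
    (hGfin : ∀ x : ℝ, Integrable (fun p : ℝ × Ω => g (x + X p.1 p.2) * Real.exp (-r * p.1))
      (((volume : Measure ℝ).restrict (Ici 0)).prod P))
    (hBfin : ∀ y : ℝ, Integrable (fun p : ℝ × Ω => g (y + B p.1 p.2) * Real.exp (-r * p.1))
      (((volume : Measure ℝ).restrict (Ici 0)).prod P))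
    {κ : ℝ → ℝ}
    (hκ : ∀ y, κ y = ∫ t in Ici (0 : ℝ), (∫ ω, g (y + B t ω) ∂P) * Real.exp (-r * t)) :
    (∀ y, Integrable (fun z => g (y + z)) (((expLaw r).prod P).map fun z => B z.1 z.2)) ∧
    (∀ y, κ y = r⁻¹ * ∫ z, g (y + z) ∂(((expLaw r).prod P).map fun z => B z.1 z.2)) ∧
    Continuous κ ∧
    ∀ x, Gfun P X g r x =
      ∫ ω, (∫ t in Ici (0 : ℝ), κ (x + A t ω) * (r * Real.exp (-r * t))) ∂P := by
  have := expLaw_isProbabilityMeasure hr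
  have hX' : AEMeasurable (fun z : ℝ × Ω => X z.1 z.2) ((expLaw r).prod P) := hX.aemeasurable
  have hgm : ∀ y, Continuous fun z => g (y + z) := fun y => by fun_prop
  have hBint : ∀ y, Integrable (fun z => g (y + z))
      (((expLaw r).prod P).map fun z : ℝ × Ω => B z.1 z.2) := fun y =>
    (integrable_map_measure (hgm y).aestronglyMeasurable hB).2 (integrable_expLaw_prod P hr (hBfin y))
  have hκ' : ∀ y, κ y =
      r⁻¹ * ∫ z, g (y + z) ∂(((expLaw r).prod P).map fun z : ℝ × Ω => B z.1 z.2) := fun y => by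
    rw [hκ, setIntegral_mul_exp hr, integral_map hB (hgm y).aestronglyMeasurable,
      integral_prod _ (integrable_expLaw_prod P hr (hBfin y))]
  have hκc : Continuous κ := by
    rw [funext hκ']
    exact (continuous_integral_translate hg hdom hBint).const_mul _
  refine ⟨hBint, hκ', hκc, fun x => ?_⟩
  have := Measure.isProbabilityMeasure_map hA
  have := Measure.isProbabilityMeasure_map hB
  have hXint : Integrable (fun z => g (x + z))
      (((expLaw r).prod P).map fun z : ℝ × Ω => X z.1 z.2) :=
    (integrable_map_measure (hgm x).aestronglyMeasurable hX').2
      (integrable_expLaw_prod P hr (hGfin x))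
  have hconv := hlaw ▸ hXint
  have hprod := (integrable_map_measure (hgm x).aestronglyMeasurable
    (measurable_fst.add measurable_snd).aemeasurable).1 hconv
  have hκint : Integrable (fun a => κ (x + a))
      (((expLaw r).prod P).map fun z : ℝ × Ω => A z.1 z.2) := by
    refine (hprod.integral_prod_left.const_mul r⁻¹).congr (ae_of_all _ fun a => ?_)
    simp [hκ', add_assoc]
  have hκm : Continuous fun a => κ (x + a) := by fun_prop
  simp_rw [Gfun, setIntegral_mul_exp hr, ← integral_expLaw hr]
  rw [integral_const_mul, ← integral_prod_symm (fun z : ℝ × Ω => g (x + X z.1 z.2))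
      (integrable_expLaw_prod P hr (hGfin x)),
    ← integral_prod_symm (fun z : ℝ × Ω => κ (x + A z.1 z.2))
      ((integrable_map_measure hκm.aestronglyMeasurable hA).1 hκint),
    ← integral_map hX' (hgm x).aestronglyMeasurable, ← integral_map hA hκm.aestronglyMeasurable,
    hlaw, integral_conv hconv, ← integral_const_mul]
  simp_rw [hκ', add_assoc]

end Representation

/-- representation of `G` through the Gittins index.
If `g` is increasing and `κ` is (absolutely) finite everywhere, then
`G(x) = E[∫_0^∞ (sup_{0≤s≤t} κ(x+X_s)) r e^{-rt} dt]`; analogously with `μ` (built from the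
running supremum) when `g` is decreasing. -/
theorem gittins_representation_of_G
    {Ω : Type*} [m : MeasurableSpace Ω] (P : Measure Ω) [IsProbabilityMeasure P]
    (X : ℝ → Ω → ℝ)
    (hXmeas : Measurable (Function.uncurry X))
    (hXsm : ∀ t, StronglyMeasurable (X t))
    (hX0 : ∀ᵐ ω ∂P, X 0 ω = 0)
    (hXrc : ∀ ω t, ContinuousWithinAt (fun s => X s ω) (Set.Ici t) t)
    (hXll : ∀ ω t, ∃ L, Tendsto (fun s => X s ω) (nhdsWithin t (Set.Iio t)) (nhds L))
    (hstat : ∀ s t : ℝ, 0 ≤ s → s ≤ t →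
      Measure.map (fun ω => X t ω - X s ω) P = Measure.map (X (t - s)) P)
    (hindep : ∀ s t : ℝ, 0 ≤ s → s ≤ t →
      ProbabilityTheory.Indep (MeasurableSpace.comap (fun ω => X t ω - X s ω) inferInstance)
        ((Filtration.natural X hXsm) s) P)
    (r : ℝ) (hr : 0 < r)
    (g : ℝ → ℝ) (hgcont : Continuous g)
    -- `G` is absolutely convergent and finite at every `x`
    (hGfin : ∀ x : ℝ, Integrable (fun p : ℝ × Ω => g (x + X p.1 p.2) * Real.exp (-r * p.1))
      (((volume : Measure ℝ).restrict (Set.Ici 0)).prod P)) :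
    (Monotone g →
      (∀ y : ℝ, Integrable (fun p : ℝ × Ω => g (y + runInf X p.1 p.2) * Real.exp (-r * p.1))
        (((volume : Measure ℝ).restrict (Set.Ici 0)).prod P)) →
      ∀ x : ℝ, Gfun P X g r x =
        ∫ ω, (∫ t in Set.Ici (0:ℝ),
          (sSup ((fun s => gittinsInf P X g r (x + X s ω)) '' Set.Icc 0 t)) *
            (r * Real.exp (-r * t))) ∂P) ∧
    (Antitone g →
      (∀ y : ℝ, Integrable (fun p : ℝ × Ω => g (y + runSup X p.1 p.2) * Real.exp (-r * p.1))
        (((volume : Measure ℝ).restrict (Set.Ici 0)).prod P)) →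
      ∀ x : ℝ, Gfun P X g r x =
        ∫ ω, (∫ t in Set.Ici (0:ℝ),
          (sSup ((fun s => gittinsSup P X g r (x + X s ω)) '' Set.Icc 0 t)) *
            (r * Real.exp (-r * t))) ∂P) := by
  obtain ⟨hS, hI, hlaw⟩ := wienerHopf P hXsm hX0 hXrc hXll hstat hindep hr
  have := expLaw_isProbabilityMeasure hr
  have hne : ∀ ω t, 0 ≤ t → ((fun s => X s ω) '' Icc 0 t).Nonempty := fun ω t ht =>
    ⟨_, mem_image_of_mem _ ⟨le_rfl, ht⟩⟩
  refine ⟨fun hg hfin x => ?_, fun hg hfin x => ?_⟩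
  · obtain ⟨hint, hκ, hκc, hrep⟩ := representation_of_factorization P hr hgcont
      hg.endpointDominated hXmeas hS hI hlaw hGfin hfin (κ := gittinsInf P X g r) fun _ => rfl
    have hmono : Monotone (gittinsInf P X g r) := fun a b hab => by
      rw [hκ, hκ]
      exact mul_le_mul_of_nonneg_left (integral_mono (hint a) (hint b) fun z =>
        hg (by linarith)) (inv_nonneg.2 hr.le)
    rw [hrep]
    refine integral_congr_ae (ae_of_all _ fun ω => setIntegral_congr_fun measurableSet_Ici
      fun t ht => ?_)
    have hsup := Monotone.map_csSup_of_continuousAt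
      (f := fun z => gittinsInf P X g r (x + z)) (by fun_prop)
      (hmono.comp (monotone_const.add monotone_id)) (hne ω t ht)
      (bddAbove_image_Icc_of_cadlag (hXrc ω) (hXll ω) 0 t)
    rw [image_image] at hsup
    simp only [← hsup, runSup]
  · obtain ⟨hint, hκ, hκc, hrep⟩ := representation_of_factorization P hr hgcont
      hg.endpointDominated hXmeas hI hS (by rw [hlaw, Measure.conv_comm]) hGfin hfin
      (κ := gittinsSup P X g r) fun _ => rfl
    have hanti : Antitone (gittinsSup P X g r) := fun a b hab => by
      rw [hκ, hκ]
      exact mul_le_mul_of_nonneg_left (integral_mono (hint b) (hint a) fun z =>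
        hg (by linarith)) (inv_nonneg.2 hr.le)
    rw [hrep]
    refine integral_congr_ae (ae_of_all _ fun ω => setIntegral_congr_fun measurableSet_Ici
      fun t ht => ?_)
    have hsup := Antitone.map_csInf_of_continuousAt
      (f := fun z => gittinsSup P X g r (x + z)) (by fun_prop)
      (hanti.comp_monotone (monotone_const.add monotone_id)) (hne ω t ht)
      (bddBelow_image_Icc_of_cadlag (hXrc ω) (hXll ω) 0 t)
    rw [image_image] at hsup
    simp only [← hsup, runInf]

end
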